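/- For every n ≥ 1 and every smooth compactly supported φ : ℝ³ → ℂⁿ, one has ∫_{ℝ³} |Δφ(z)|² dz + ∫_{ℝ³} |z|⁴·|φ(z)|² dz ≤ (5/3)·∫_{ℝ³} |−Δφ(z) + |z|²·φ(z)|² dz. -/

import Mathlib

open MeasureTheory

noncomputable section

/-- The partial derivative `∂ᵢf` of a function on `ℝ³`. -/
def pd {F : Type*} [NormedAddCommGroup F] [NormedSpace ℝ F]
    (i : Fin 3) (f : EuclideanSpace ℝ (Fin 3) → F) (z : EuclideanSpace ℝ (Fin 3)) : F :=
  fderiv ℝ f z (EuclideanSpace.single i 1)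

/-- The Laplacian on `ℝ³`, acting componentwise. -/
def lap {F : Type*} [NormedAddCommGroup F] [NormedSpace ℝ F]
    (f : EuclideanSpace ℝ (Fin 3) → F) (z : EuclideanSpace ℝ (Fin 3)) : F :=
  ∑ i : Fin 3, pd i (pd i f) z

section InnerValued

local notation "E₃" => EuclideanSpace ℝ (Fin 3)

variable {F : Type*} [NormedAddCommGroup F] [InnerProductSpace ℝ F]

open scoped RealInnerProductSpace

lemma contDiff_pd {f : E₃ → F} (hf : ContDiff ℝ (⊤ : ℕ∞) f) (i : Fin 3) :
    ContDiff ℝ (⊤ : ℕ∞) (pd i f) :=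
  (hf.fderiv_right (m := (⊤ : ℕ∞)) (by simp)).clm_apply contDiff_const

lemma hasCompactSupport_pd {f : E₃ → F} (hf : HasCompactSupport f) (i : Fin 3) :
    HasCompactSupport (pd i f) :=
  hf.fderiv_apply ℝ _

lemma integrable_inner_of_hasCompactSupport {f g : E₃ → F} (hf : Continuous f) (hg : Continuous g)
    (hs : HasCompactSupport f) : Integrable (fun z ↦ ⟪f z, g z⟫) := by
  refine (hf.inner hg).integrable_of_hasCompactSupport (hs.mono fun z hz hz' ↦ hz ?_)
  simp [hz']

/-- Integration by parts against the inner product. -/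
lemma integral_inner_pd {f g : E₃ → F} (hf : ContDiff ℝ (⊤ : ℕ∞) f)
    (hg : ContDiff ℝ (⊤ : ℕ∞) g) (hs : HasCompactSupport f) (i : Fin 3) :
    ∫ z, ⟪f z, pd i g z⟫ = -∫ z, ⟪pd i f z, g z⟫ :=
  integral_bilinear_fderiv_right_eq_neg_left_of_integrable (B := innerSL ℝ)
    (integrable_inner_of_hasCompactSupport (contDiff_pd hf i).continuous hg.continuous
      (hasCompactSupport_pd hs i))
    (integrable_inner_of_hasCompactSupport hf.continuous (contDiff_pd hg i).continuous hs)
    (integrable_inner_of_hasCompactSupport hf.continuous hg.continuous hs)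
    (fun _ _ ↦ hf.differentiable (by simp) _) (fun _ _ ↦ hg.differentiable (by simp) _)

lemma contDiff_coord (i : Fin 3) : ContDiff ℝ (⊤ : ℕ∞) (fun z : E₃ ↦ z i) := by
  fun_prop

lemma pd_coord_smul {f : E₃ → F} (hf : ContDiff ℝ (⊤ : ℕ∞) f) (i : Fin 3) (z : E₃) :
    pd i (fun z ↦ z i • f z) z = f z + z i • pd i f z := by
  have h1 : HasFDerivAt (fun z : E₃ ↦ z i) (EuclideanSpace.proj (𝕜 := ℝ) i) z :=
    (EuclideanSpace.proj (𝕜 := ℝ) i).hasFDerivAt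
  have h2 := (hf.differentiable (by simp) z).hasFDerivAt
  have h3 : HasFDerivAt (fun z : E₃ ↦ z i • f z) _ z := h1.smul h2
  simp [pd, h3.fderiv, add_comm]

lemma pd_norm_sq_smul {f : E₃ → F} (hf : ContDiff ℝ (⊤ : ℕ∞) f) (i : Fin 3) (z : E₃) :
    pd i (fun z ↦ ‖z‖ ^ 2 • f z) z = (2 * z i) • f z + ‖z‖ ^ 2 • pd i f z := by
  have h1 := (hasStrictFDerivAt_norm_sq z).hasFDerivAt
  have h2 := (hf.differentiable (by simp) z).hasFDerivAt
  have h3 : HasFDerivAt (fun z : E₃ ↦ ‖z‖ ^ 2 • f z) _ z := h1.smul h2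
  simp [pd, h3.fderiv, add_comm, EuclideanSpace.inner_single_right]

lemma integral_inner_coord_smul_pd {u : E₃ → F} (hu : ContDiff ℝ (⊤ : ℕ∞) u)
    (hs : HasCompactSupport u) (i : Fin 3) :
    ∫ z, ⟪u z, z i • pd i u z⟫ = -(1 / 2) * ∫ z, ⟪u z, u z⟫ := by
  have hc := hu.continuous
  have hd := (contDiff_pd hu i).continuous
  have h := integral_inner_pd hu ((contDiff_coord i).smul hu) hs i
  have e1 : (fun z ↦ ⟪u z, pd i (fun z ↦ z i • u z) z⟫) =
      fun z ↦ ⟪u z, u z⟫ + ⟪u z, z i • pd i u z⟫ := by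
    ext z; rw [pd_coord_smul hu, inner_add_right]
  have e2 : (fun z ↦ ⟪pd i u z, z i • u z⟫) = fun z ↦ ⟪u z, z i • pd i u z⟫ := by
    ext z; rw [inner_smul_right, inner_smul_right, real_inner_comm]
  simp only [Pi.smul_def'] at h
  rw [e1, e2, integral_add (integrable_inner_of_hasCompactSupport hc hc hs)
    (integrable_inner_of_hasCompactSupport hc (by fun_prop) hs)] at h
  linarith

lemma integral_inner_norm_sq_smul_pd_pd_le {u : E₃ → F} (hu : ContDiff ℝ (⊤ : ℕ∞) u)
    (hs : HasCompactSupport u) (i : Fin 3) :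
    ∫ z, ⟪‖z‖ ^ 2 • u z, pd i (pd i u) z⟫ ≤ ∫ z, ⟪u z, u z⟫ := by
  have hc := hu.continuous
  have hd := (contDiff_pd hu i).continuous
  have hw : HasCompactSupport (fun z ↦ ‖z‖ ^ 2 • u z) := hs.smul_left
  have hwd : ContDiff ℝ (⊤ : ℕ∞) (fun z ↦ ‖z‖ ^ 2 • u z) := (contDiff_norm_sq ℝ).smul hu
  rw [integral_inner_pd hwd (contDiff_pd hu i) hw i]
  have e : (fun z ↦ ⟪pd i (fun z ↦ ‖z‖ ^ 2 • u z) z, pd i u z⟫) =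
      fun z ↦ 2 * ⟪u z, z i • pd i u z⟫ + ⟪pd i u z, ‖z‖ ^ 2 • pd i u z⟫ := by
    ext z
    rw [pd_norm_sq_smul hu, inner_add_left, inner_smul_left, inner_smul_left, inner_smul_right,
      inner_smul_right]
    simp [mul_assoc]
  have hX : 0 ≤ ∫ z, ⟪pd i u z, ‖z‖ ^ 2 • pd i u z⟫ := integral_nonneg fun z ↦ by
    simp only [Pi.zero_apply, inner_smul_right, real_inner_self_eq_norm_sq]
    positivity
  rw [e, integral_add ((integrable_inner_of_hasCompactSupport hc (by fun_prop) hs).const_mul 2)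
    (integrable_inner_of_hasCompactSupport hd (by fun_prop) (hasCompactSupport_pd hs i)),
    integral_const_mul, integral_inner_coord_smul_pd hu hs]
  linarith

/-- The lower bound for the one-dimensional harmonic oscillator in the `i`-th coordinate. -/
lemma integral_inner_self_le_oscillator {u : E₃ → F} (hu : ContDiff ℝ (⊤ : ℕ∞) u)
    (hs : HasCompactSupport u) (i : Fin 3) :
    ∫ z, ⟪u z, u z⟫ ≤ (∫ z, ⟪u z, z i ^ 2 • u z⟫) - ∫ z, ⟪u z, pd i (pd i u) z⟫ := by
  have hc := hu.continuous
  have hd := (contDiff_pd hu i).continuous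
  rw [integral_inner_pd hu (contDiff_pd hu i) hs i]
  have h : 0 ≤ ∫ z, ⟪pd i u z + z i • u z, pd i u z + z i • u z⟫ :=
    integral_nonneg fun z ↦ real_inner_self_nonneg
  have e : (fun z ↦ ⟪pd i u z + z i • u z, pd i u z + z i • u z⟫) =
      fun z ↦ ⟪pd i u z, pd i u z⟫ + ⟪u z, z i ^ 2 • u z⟫ + 2 * ⟪u z, z i • pd i u z⟫ := by
    ext z
    rw [real_inner_add_add_self]
    simp only [inner_smul_right, real_inner_comm (u z)]
    ring
  have i1 := integrable_inner_of_hasCompactSupport hd hd (hasCompactSupport_pd hs i)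
  have i2 : Integrable fun z ↦ ⟪u z, z i ^ 2 • u z⟫ :=
    integrable_inner_of_hasCompactSupport hc (by fun_prop) hs
  have i3 : Integrable fun z ↦ ⟪u z, z i • pd i u z⟫ :=
    integrable_inner_of_hasCompactSupport hc (by fun_prop) hs
  have i12 : Integrable fun z ↦ ⟪pd i u z, pd i u z⟫ + ⟪u z, z i ^ 2 • u z⟫ := i1.add i2
  rw [e, integral_add i12 (i3.const_mul 2), integral_add i1 i2, integral_const_mul,
    integral_inner_coord_smul_pd hu hs] at h
  linarith

lemma integral_norm_sq_lap_add_le {u : E₃ → F} (hu : ContDiff ℝ (⊤ : ℕ∞) u)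
    (hs : HasCompactSupport u) :
    (∫ z, ‖lap u z‖ ^ 2) + (∫ z, ‖z‖ ^ 4 * ‖u z‖ ^ 2) ≤
      (5 / 3) * ∫ z, ‖-lap u z + ‖z‖ ^ 2 • u z‖ ^ 2 := by
  have hc := hu.continuous
  have hdd i := (contDiff_pd (contDiff_pd hu i) i).continuous
  have hL : Continuous (lap u) := continuous_finsetSum _ fun i _ ↦ hdd i
  have hLs : HasCompactSupport (lap u) := by
    have h i := hasCompactSupport_pd (hasCompactSupport_pd hs i) i
    have : lap u = pd 0 (pd 0 u) + pd 1 (pd 1 u) + pd 2 (pd 2 u) := by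
      ext z; simp [lap, Fin.sum_univ_three]
    rw [this]
    exact ((h 0).add (h 1)).add (h 2)
  have hw : HasCompactSupport (fun z ↦ ‖z‖ ^ 2 • u z) := hs.smul_left
  have hwc : Continuous (fun z ↦ ‖z‖ ^ 2 • u z) := by fun_prop
  have iLL := integrable_inner_of_hasCompactSupport hL hL hLs
  have iww := integrable_inner_of_hasCompactSupport hwc hwc hw
  have iwL := integrable_inner_of_hasCompactSupport hwc hL hw
  have iuL := integrable_inner_of_hasCompactSupport hc hL hs
  have iuw := integrable_inner_of_hasCompactSupport hc hwc hs
  have iuu := integrable_inner_of_hasCompactSupport hc hc hs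
  have i₁ : Integrable fun z ↦ ⟪lap u z, lap u z⟫ + ⟪‖z‖ ^ 2 • u z, ‖z‖ ^ 2 • u z⟫ := iLL.add iww
  have i₂ : Integrable fun z ↦ ⟪lap u z, lap u z⟫ + ⟪‖z‖ ^ 2 • u z, ‖z‖ ^ 2 • u z⟫ -
      2 * ⟪‖z‖ ^ 2 • u z, lap u z⟫ := i₁.sub (iwL.const_mul 2)
  have i₃ : Integrable fun z ↦ ⟪lap u z, lap u z⟫ + ⟪‖z‖ ^ 2 • u z, ‖z‖ ^ 2 • u z⟫ -
      2 * ⟪‖z‖ ^ 2 • u z, lap u z⟫ + 6 * ⟪u z, lap u z⟫ := i₂.add (iuL.const_mul 6)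
  have i₄ : Integrable fun z ↦ ⟪lap u z, lap u z⟫ + ⟪‖z‖ ^ 2 • u z, ‖z‖ ^ 2 • u z⟫ -
      2 * ⟪‖z‖ ^ 2 • u z, lap u z⟫ + 6 * ⟪u z, lap u z⟫ - 6 * ⟪u z, ‖z‖ ^ 2 • u z⟫ :=
    i₃.sub (iuw.const_mul 6)
  have hsq : ∫ z, ‖-lap u z + ‖z‖ ^ 2 • u z‖ ^ 2 =
      (∫ z, ⟪lap u z, lap u z⟫) + (∫ z, ⟪‖z‖ ^ 2 • u z, ‖z‖ ^ 2 • u z⟫) -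
        2 * ∫ z, ⟪‖z‖ ^ 2 • u z, lap u z⟫ := by
    rw [← integral_const_mul, ← integral_add iLL iww,
      ← integral_sub i₁ (iwL.const_mul 2)]
    congr 1 with z
    rw [← real_inner_self_eq_norm_sq, real_inner_add_add_self, inner_neg_left, inner_neg_left,
      inner_neg_right, real_inner_comm (‖z‖ ^ 2 • u z) (lap u z)]
    ring
  have hcross : ∫ z, ⟪‖z‖ ^ 2 • u z, lap u z⟫ ≤ 3 * ∫ z, ⟪u z, u z⟫ := by
    have e : (fun z ↦ ⟪‖z‖ ^ 2 • u z, lap u z⟫) =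
        fun z ↦ ∑ i, ⟪‖z‖ ^ 2 • u z, pd i (pd i u) z⟫ := by
      ext z; rw [lap, inner_sum]
    rw [e, integral_finsetSum _ fun i _ ↦ integrable_inner_of_hasCompactSupport hwc (hdd i) hw]
    refine (Finset.sum_le_sum fun i _ ↦ integral_inner_norm_sq_smul_pd_pd_le hu hs i).trans ?_
    simp
  have hosc : 3 * ∫ z, ⟪u z, u z⟫ ≤
      (∫ z, ⟪u z, ‖z‖ ^ 2 • u z⟫) - ∫ z, ⟪u z, lap u z⟫ := by
    have e1 : (fun z ↦ ⟪u z, lap u z⟫) = fun z ↦ ∑ i, ⟪u z, pd i (pd i u) z⟫ := by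
      ext z; rw [lap, inner_sum]
    have e2 : (fun z ↦ ⟪u z, ‖z‖ ^ 2 • u z⟫) = fun z ↦ ∑ i, ⟪u z, z i ^ 2 • u z⟫ := by
      ext z; rw [EuclideanSpace.real_norm_sq_eq, Finset.sum_smul, inner_sum]
    rw [e1, e2, integral_finsetSum _ fun i _ ↦ integrable_inner_of_hasCompactSupport hc (hdd i) hs,
      integral_finsetSum _ fun i _ ↦
        integrable_inner_of_hasCompactSupport hc (by fun_prop) hs, ← Finset.sum_sub_distrib]
    refine le_trans ?_ (Finset.sum_le_sum fun i _ ↦ integral_inner_self_le_oscillator hu hs i)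
    simp
  have hgap : 0 ≤ (∫ z, ⟪lap u z, lap u z⟫) + (∫ z, ⟪‖z‖ ^ 2 • u z, ‖z‖ ^ 2 • u z⟫) -
        2 * (∫ z, ⟪‖z‖ ^ 2 • u z, lap u z⟫) + 6 * (∫ z, ⟪u z, lap u z⟫) -
        6 * (∫ z, ⟪u z, ‖z‖ ^ 2 • u z⟫) + 9 * ∫ z, ⟪u z, u z⟫ := by
    simp only [← integral_const_mul]
    rw [← integral_add iLL iww, ← integral_sub i₁ (iwL.const_mul 2),
      ← integral_add i₂ (iuL.const_mul 6), ← integral_sub i₃ (iuw.const_mul 6),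
      ← integral_add i₄ (iuu.const_mul 9)]
    refine integral_nonneg fun z ↦ ?_
    have h := real_inner_self_nonneg (x := ‖z‖ ^ 2 • u z - lap u z - (3 : ℝ) • u z)
    rw [real_inner_sub_sub_self, real_inner_sub_sub_self, inner_sub_left] at h
    simp only [inner_smul_left, inner_smul_right, real_inner_comm (u z), conj_trivial,
      Pi.zero_apply] at h ⊢
    linarith
  have ea : ∫ z, ‖lap u z‖ ^ 2 = ∫ z, ⟪lap u z, lap u z⟫ := by
    simp only [real_inner_self_eq_norm_sq]
  have eb : ∫ z, ‖z‖ ^ 4 * ‖u z‖ ^ 2 = ∫ z, ⟪‖z‖ ^ 2 • u z, ‖z‖ ^ 2 • u z⟫ := by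
    congr 1 with z
    rw [real_inner_self_eq_norm_sq, norm_smul, norm_pow, norm_norm]
    ring
  rw [ea, eb, hsq]
  linarith

end InnerValued

/-- For smooth compactly supported `φ : ℝ³ → ℂⁿ`:
`∫‖Δφ‖² + ∫|z|⁴‖φ‖² ≤ (5/3)∫‖−Δφ + |z|²φ‖²`. -/
theorem stmt_19 (n : ℕ) (hn : 1 ≤ n)
    (φ : EuclideanSpace ℝ (Fin 3) → EuclideanSpace ℂ (Fin n))
    (hφ : ContDiff ℝ (⊤ : ℕ∞) φ) (hsupp : HasCompactSupport φ) :
    (∫ z, ‖lap φ z‖ ^ 2) + (∫ z, ‖z‖ ^ 4 * ‖φ z‖ ^ 2) ≤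
      (5 / 3) * ∫ z, ‖-lap φ z + ‖z‖ ^ 2 • φ z‖ ^ 2 := by
  exact integral_norm_sq_lap_add_le hφ hsupp

end
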